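/- arXiv:0811.4602 — 4 statements merged into one kernel-verified Lean document; each statement's English description precedes it below -/
import Mathlib

section
/- Let κ > 0 and let G be a twice continuously differentiable real function on (−∞, 0). Define g(s) = G(−(2/3)√(s/κ)) for s > 0. Then for every s > 0, writing h = −(2/3)√(s/κ), one has s(1−s)g''(s) − (1/2)g'(s) − (5/36)g(s) = −(h/(16s))·[ h(9κh² − 4)G''(h) − (9κh² − 8)G'(h) + 5κh·G(h) ]. In particular, G satisfies L₂G = 0 on (−∞, −2/(3√κ)) if and only if g satisfies the hypergeometric-type equation s(1−s)g'' − (1/2)g' − (5/36)g = 0 on (1, ∞). -/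
/-- The substitution `s ↦ -(2/3)√(s/κ)` has derivative `h/(2s)`. -/
theorem hasDerivAt_neg_sqrt_div {κ s : ℝ} (hκ : 0 < κ) (hs : 0 < s) :
    HasDerivAt (fun s : ℝ => -(2 / 3) * Real.sqrt (s / κ))
      (-(2 / 3) * Real.sqrt (s / κ) / (2 * s)) s := by
  have hpos : 0 < s / κ := div_pos hs hκ
  have hsq : Real.sqrt (s / κ) ^ 2 = s / κ := Real.sq_sqrt hpos.le
  have hne : Real.sqrt (s / κ) ≠ 0 := (Real.sqrt_pos.2 hpos).ne'
  refine ((((hasDerivAt_id s).div_const κ).sqrt hpos.ne').const_mul (-(2 / 3))).congr_deriv ?_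
  simp only [id]
  have hs' : s = κ * Real.sqrt (s / κ) ^ 2 := by rw [hsq]; field_simp
  generalize Real.sqrt (s / κ) = r at hs' hne
  subst hs'
  field_simp

theorem neg_sqrt_div_neg {κ s : ℝ} (hκ : 0 < κ) (hs : 0 < s) :
    -(2 / 3) * Real.sqrt (s / κ) < 0 := by
  have := Real.sqrt_pos.2 (div_pos hs hκ)
  linarith

/-- First and second derivatives of `s ↦ G (-(2/3)√(s/κ))` for `s > 0`. -/
theorem deriv_comp_neg_sqrt_div {κ : ℝ} (hκ : 0 < κ) {G g : ℝ → ℝ}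
    (hG : ContDiffOn ℝ 2 G (Set.Iio (0 : ℝ)))
    (hg : ∀ s : ℝ, g s = G (-(2 / 3) * Real.sqrt (s / κ))) {s h : ℝ} (hs : 0 < s)
    (hh : h = -(2 / 3) * Real.sqrt (s / κ)) :
    deriv g s = deriv G h * (h / (2 * s)) ∧
      deriv (deriv g) s =
        deriv (deriv G) h * (h / (2 * s)) ^ 2 - deriv G h * (h / (4 * s ^ 2)) := by
  have hG' : ContDiffOn ℝ 1 (deriv G) (Set.Iio (0 : ℝ)) :=
    hG.deriv_of_isOpen isOpen_Iio (by norm_num)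
  have differentiableAt {F : ℝ → ℝ} {n : WithTop ℕ∞} (hn : n ≠ 0)
      (hF : ContDiffOn ℝ n F (Set.Iio (0 : ℝ))) {x : ℝ} (hx : x < 0) :
      DifferentiableAt ℝ F x :=
    (hF.differentiableOn hn).differentiableAt (Iio_mem_nhds hx)
  have first : ∀ t : ℝ, 0 < t → deriv g t =
      deriv G (-(2 / 3) * Real.sqrt (t / κ)) * (-(2 / 3) * Real.sqrt (t / κ) / (2 * t)) := by
    intro t ht
    rw [funext hg]
    exact ((differentiableAt two_ne_zero hG (neg_sqrt_div_neg hκ ht)).hasDerivAt.comp t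
      (hasDerivAt_neg_sqrt_div hκ ht)).deriv
  refine ⟨by rw [first s hs, hh], ?_⟩
  have hev : deriv g =ᶠ[nhds s] fun t =>
      deriv G (-(2 / 3) * Real.sqrt (t / κ)) * (-(2 / 3) * Real.sqrt (t / κ) / (2 * t)) := by
    filter_upwards [Ioi_mem_nhds hs] with t ht using first t ht
  have hφ := hasDerivAt_neg_sqrt_div hκ hs
  have houter := (differentiableAt one_ne_zero hG' (neg_sqrt_div_neg hκ hs)).hasDerivAt.comp s hφ
  have hinner := hφ.fun_div ((hasDerivAt_id s).const_mul 2)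
    (mul_ne_zero two_ne_zero hs.ne')
  rw [hev.deriv_eq]
  refine (houter.mul hinner).deriv.trans ?_
  simp only [id, Function.comp_apply, ← hh]
  field_simp
  ring

/-- Substituting `h = -(2/3)√(s/κ)` transforms the operator
`(L₂x)(h) = h(9κh² − 4)x'' − (9κh² − 8)x' + 5κh·x` into the hypergeometric-type
operator `s(1−s)d²/ds² − (1/2)d/ds − 5/36`, up to the nonvanishing factor `−h/(16s)`;
in particular `L₂G = 0` on `(-∞, -2/(3√κ))` iff `g(s) = G(-(2/3)√(s/κ))` satisfies
`s(1−s)g'' − (1/2)g' − (5/36)g = 0` on `(1, ∞)`. -/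
theorem L2_transforms_to_hypergeometric (κ : ℝ) (hκ : 0 < κ)
    (G : ℝ → ℝ) (hG : ContDiffOn ℝ 2 G (Set.Iio (0 : ℝ)))
    (g : ℝ → ℝ) (hg : ∀ s : ℝ, g s = G (-(2 / 3) * Real.sqrt (s / κ))) :
    (∀ s : ℝ, 0 < s → ∀ h : ℝ, h = -(2 / 3) * Real.sqrt (s / κ) →
      s * (1 - s) * deriv (deriv g) s - 1 / 2 * deriv g s - 5 / 36 * g s =
        -(h / (16 * s)) *
          (h * (9 * κ * h ^ 2 - 4) * deriv (deriv G) h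
            - (9 * κ * h ^ 2 - 8) * deriv G h + 5 * κ * h * G h)) ∧
    ((∀ h ∈ Set.Iio (-2 / (3 * Real.sqrt κ)),
        h * (9 * κ * h ^ 2 - 4) * deriv (deriv G) h
          - (9 * κ * h ^ 2 - 8) * deriv G h + 5 * κ * h * G h = 0) ↔
      (∀ s ∈ Set.Ioi (1 : ℝ),
        s * (1 - s) * deriv (deriv g) s - 1 / 2 * deriv g s - 5 / 36 * g s = 0)) := by
  have key : ∀ s : ℝ, 0 < s → ∀ h : ℝ, h = -(2 / 3) * Real.sqrt (s / κ) →
      s * (1 - s) * deriv (deriv g) s - 1 / 2 * deriv g s - 5 / 36 * g s =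
        -(h / (16 * s)) *
          (h * (9 * κ * h ^ 2 - 4) * deriv (deriv G) h
            - (9 * κ * h ^ 2 - 8) * deriv G h + 5 * κ * h * G h) := by
    intro s hs h hh
    obtain ⟨hd, hdd⟩ := deriv_comp_neg_sqrt_div hκ hG hg hs hh
    have hs' : s = 9 * κ * h ^ 2 / 4 := by
      rw [hh, mul_pow, Real.sq_sqrt (div_pos hs hκ).le]
      field_simp
      norm_num
    have hne : h ≠ 0 := hh ▸ (neg_sqrt_div_neg hκ hs).ne
    rw [hd, hdd, hg s, ← hh, hs']
    field_simp
    ring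
  have hκ' : 0 < Real.sqrt κ := Real.sqrt_pos.2 hκ
  refine ⟨key, fun H s hs => ?_, fun H h hh => ?_⟩
  · have hs1 : 1 < s := hs
    have hs0 : 0 < s := one_pos.trans hs1
    rw [key s hs0 _ rfl, H, mul_zero]
    have hsqrt : 1 < Real.sqrt s := Real.lt_sqrt_of_sq_lt (by simpa using hs1)
    rw [Set.mem_Iio, Real.sqrt_div hs0.le, lt_div_iff₀ (by positivity)]
    field_simp
    linarith
  · have hlt : 1 < -h * (3 / 2) * Real.sqrt κ := by
      rw [Set.mem_Iio, lt_div_iff₀ (by positivity)] at hh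
      linarith
    have hneg : h < 0 := by
      by_contra! hn
      nlinarith [mul_nonneg hn hκ'.le]
    have hs1 : 1 < 9 * κ * h ^ 2 / 4 := by
      have := one_lt_pow₀ hlt two_ne_zero
      rw [mul_pow, Real.sq_sqrt hκ.le] at this
      linarith
    have hs0 := one_pos.trans hs1
    have hh' : h = -(2 / 3) * Real.sqrt (9 * κ * h ^ 2 / 4 / κ) := by
      have : 9 * κ * h ^ 2 / 4 / κ = (-h * (3 / 2)) ^ 2 := by
        field_simp
        ring
      rw [this, Real.sqrt_sq (by linarith)]
      ring
    have hz := (key _ hs0 h hh').symm.trans (H _ hs1)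
    refine (mul_eq_zero.1 hz).resolve_left (neg_ne_zero.2 (div_ne_zero hneg.ne ?_))
    exact (mul_pos (by norm_num) hs0).ne'
end

section
/- Let b, c be real numbers with b² + c² = 4 and c ≠ 0, and set κ = 4/(2+b), Y(x,y) = cx − (2+b)y, φ(x,y) = 8y(1 + Y) − (2/3)(1 + κY³), ψ(x,y) = 1 − 8y + κY². Let P(x,y) = y + (6+b)x² − (2+b)y² + 2cxy and Q(x,y) = −x + cx² − cy² + (8−2b)xy (the real form of the quadratic system ż = −iz + 4z² + 2|z|² + (b+ic)z̄² with z = x+iy). Then ℋ(x,y) = φ(x,y)²/ψ(x,y)³ is a first integral of the system: for every (x,y) with ψ(x,y) ≠ 0, P(x,y)·∂ℋ/∂x(x,y) + Q(x,y)·∂ℋ/∂y(x,y) = 0. -/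
/-- If `φ` and `ψ` have cofactors `3K` and `2K` along the direction `(p, q)`, then the quotient
`φ² / ψ³` has zero derivative along that direction. -/
theorem deriv_sq_div_cube_eq_zero_of_cofactors {f₁ f₂ g₁ g₂ : ℝ → ℝ}
    {x y p q K f g a₁ a₂ b₁ b₂ : ℝ}
    (hf₁ : HasDerivAt f₁ a₁ x) (hf₂ : HasDerivAt f₂ a₂ y)
    (hg₁ : HasDerivAt g₁ b₁ x) (hg₂ : HasDerivAt g₂ b₂ y)
    (ef₁ : f₁ x = f) (ef₂ : f₂ y = f) (eg₁ : g₁ x = g) (eg₂ : g₂ y = g) (hg : g ≠ 0)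
    (hf : p * a₁ + q * a₂ = 3 * K * f) (hgK : p * b₁ + q * b₂ = 2 * K * g) :
    p * deriv (fun u => f₁ u ^ 2 / g₁ u ^ 3) x +
      q * deriv (fun v => f₂ v ^ 2 / g₂ v ^ 3) y = 0 := by
  have h₁ := (hf₁.fun_pow 2).fun_div (hg₁.fun_pow 3) (pow_ne_zero 3 (eg₁ ▸ hg))
  have h₂ := (hf₂.fun_pow 2).fun_div (hg₂.fun_pow 3) (pow_ne_zero 3 (eg₂ ▸ hg))
  rw [h₁.deriv, h₂.deriv, ef₁, ef₂, eg₁, eg₂]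
  field_simp
  push_cast
  linear_combination 2 * g ^ 3 * f * hf - 3 * g ^ 2 * f ^ 2 * hgK

/-- `ℋ = φ²/ψ³` is a first integral of the codimension-four quadratic system
`ż = −iz + 4z² + 2|z|² + (b+ic)z̄²` written in real coordinates: wherever `ψ ≠ 0`,
`P·∂ℋ/∂x + Q·∂ℋ/∂y = 0`. -/
theorem rational_first_integral_of_Q4
    (b c : ℝ) (hbc : b ^ 2 + c ^ 2 = 4) (hc : c ≠ 0)
    (κ : ℝ) (hκ : κ = 4 / (2 + b))
    (Y φ ψ P Q ℋ : ℝ → ℝ → ℝ)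
    (hY : ∀ x y : ℝ, Y x y = c * x - (2 + b) * y)
    (hφ : ∀ x y : ℝ, φ x y = 8 * y * (1 + Y x y) - 2 / 3 * (1 + κ * (Y x y) ^ 3))
    (hψ : ∀ x y : ℝ, ψ x y = 1 - 8 * y + κ * (Y x y) ^ 2)
    (hP : ∀ x y : ℝ,
      P x y = y + (6 + b) * x ^ 2 - (2 + b) * y ^ 2 + 2 * c * x * y)
    (hQ : ∀ x y : ℝ,
      Q x y = -x + c * x ^ 2 - c * y ^ 2 + (8 - 2 * b) * x * y)
    (hℋ : ∀ x y : ℝ, ℋ x y = (φ x y) ^ 2 / (ψ x y) ^ 3) :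
    ∀ x y : ℝ, ψ x y ≠ 0 →
      P x y * deriv (fun u => ℋ u y) x + Q x y * deriv (fun v => ℋ x v) y = 0 := by
  intro x y hψ0
  have hs : 2 + b ≠ 0 := by
    intro h
    have hb : b = -2 := by linarith
    apply hc
    simpa [hb] using show c ^ 2 = 0 by rw [hb] at hbc; linarith
  have hκs : κ * (2 + b) = 4 := by rw [hκ]; field_simp
  have hYx : HasDerivAt (fun u => Y u y) c x := by
    simp only [hY]
    simpa using ((hasDerivAt_id x).const_mul c).sub_const ((2 + b) * y)
  have hYy : HasDerivAt (fun v => Y x v) (-(2 + b)) y := by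
    simp only [hY]
    simpa using ((hasDerivAt_id y).const_mul (2 + b)).const_sub (c * x)
  have hφx : HasDerivAt (fun u => φ u y) (8 * y * c - 2 * κ * Y x y ^ 2 * c) x := by
    simp only [hφ]
    refine HasDerivAt.congr_deriv (((hYx.const_add 1).const_mul (8 * y)).fun_sub
      ((((hYx.fun_pow 3).const_mul κ).const_add 1).const_mul (2 / 3))) ?_
    push_cast
    ring
  have hφy : HasDerivAt (fun v => φ x v)
      (8 * (1 + Y x y) - 8 * y * (2 + b) + 2 * κ * Y x y ^ 2 * (2 + b)) y := by
    simp only [hφ]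
    refine HasDerivAt.congr_deriv
      ((((hasDerivAt_id' y).const_mul 8).fun_mul (hYy.const_add 1)).fun_sub
        ((((hYy.fun_pow 3).const_mul κ).const_add 1).const_mul (2 / 3))) ?_
    push_cast
    ring
  have hψx : HasDerivAt (fun u => ψ u y) (2 * κ * Y x y * c) x := by
    simp only [hψ]
    refine HasDerivAt.congr_deriv (((hYx.fun_pow 2).const_mul κ).const_add (1 - 8 * y)) ?_
    push_cast
    ring
  have hψy : HasDerivAt (fun v => ψ x v) (-8 - 2 * κ * Y x y * (2 + b)) y := by
    simp only [hψ]
    refine HasDerivAt.congr_deriv ((((hasDerivAt_id' y).const_mul 8).const_sub 1).fun_add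
      ((hYy.fun_pow 2).const_mul κ)) ?_
    push_cast
    ring
  simp only [hℋ]
  refine deriv_sq_div_cube_eq_zero_of_cofactors (K := 4 * x) hφx hφy hψx hψy
    rfl rfl rfl rfl hψ0 ?_ ?_
  · rw [hP, hQ, hφ, hY]
    grind
  · rw [hP, hQ, hψ, hY]
    grind
end

section
/- Let κ, h ∈ ℝ and let γ(t) = (x(t), y(t)), t ∈ [0,1], be a continuously differentiable closed curve (γ(0) = γ(1)) such that x(t) ≠ 0 for all t and (κ/3)y(t)³ − x(t)²y(t) − h·x(t)³ − (κ−1)y(t) + (2/3)(κ−1) = 0 for all t. For integers a, b write A_{a,b} = ∫₀¹ x(t)^a y(t)^b x'(t) dt. Then for all integers i and j with j ∉ {−1, −2, −4}: κ(i+j+5)/(j+4) · A_{i,j+4} − (i+j+5)/(j+2) · A_{i+2,j+2} − (κ−1)(i+3j+7)/(j+2) · A_{i,j+2} + 2(κ−1) · A_{i,j+1} = 0. -/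
open Set MeasureTheory Filter Topology

/-- A continuous function on a compact set that factors through a continuous real function `u`
factors as `W ∘ u` with `W` continuous on the whole line. -/
lemma exists_continuous_comp_eqOn {S : Set ℝ} (hS : IsCompact S) {u w : ℝ → ℝ}
    (hu : ContinuousOn u S) (hw : ContinuousOn w S)
    (hfac : ∀ s ∈ S, ∀ t ∈ S, u s = u t → w s = w t) :
    ∃ W : ℝ → ℝ, Continuous W ∧ ∀ t ∈ S, w t = W (u t) := by
  have : CompactSpace S := isCompact_iff_compactSpace.mp hS
  let f : S → u '' S := fun t => ⟨u t, mem_image_of_mem u t.2⟩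
  have hf : Continuous f := (continuousOn_iff_continuous_domRestrict.mp hu).subtype_mk _
  have hfs : Function.Surjective f := by
    rintro ⟨_, t, ht, rfl⟩
    exact ⟨⟨t, ht⟩, rfl⟩
  have hq : IsQuotientMap f := hf.isClosedMap.isQuotientMap hf hfs
  let F : C(S, u '' S) := ⟨f, hf⟩
  let g : C(S, ℝ) := ⟨S.domRestrict w, continuousOn_iff_continuous_domRestrict.mp hw⟩
  have hg : Function.FactorsThrough g F := fun s t hst =>
    hfac s s.2 t t.2 (congrArg Subtype.val hst)
  obtain ⟨W, hW⟩ := ContinuousMap.exists_restrict_eq (hS.image_of_continuousOn hu).isClosed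
    (IsQuotientMap.lift (f := F) hq g hg)
  refine ⟨W, W.continuous, fun t ht => ?_⟩
  have h1 := congrArg (fun k : C(S, ℝ) => k ⟨t, ht⟩) (IsQuotientMap.lift_comp (f := F) hq g hg)
  have h2 := congrArg (fun k : C(u '' S, ℝ) => k (F ⟨t, ht⟩)) hW
  exact h1.symm.trans h2.symm

/-- If a loop is covered by the two sheets `y ≤ 1` and `y ≥ 1`, on each of which `w` is a function
of `u`, and the sheets meet over a single value of `u`, then `∮ w du = 0`. -/
lemma integral_mul_deriv_eq_zero_of_two_sheets {u w y u' : ℝ → ℝ}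
    (hu : ∀ t ∈ Icc (0 : ℝ) 1, HasDerivWithinAt u (u' t) (Icc 0 1) t)
    (hu'c : ContinuousOn u' (Icc 0 1))
    (hw : ContinuousOn w (Icc 0 1)) (hy : ContinuousOn y (Icc 0 1))
    (hu01 : u 0 = u 1) (hy01 : y 0 = y 1)
    (hlow : ∀ s ∈ Icc (0 : ℝ) 1, ∀ t ∈ Icc (0 : ℝ) 1, y s ≤ 1 → y t ≤ 1 → u s = u t → w s = w t)
    (hup : ∀ s ∈ Icc (0 : ℝ) 1, ∀ t ∈ Icc (0 : ℝ) 1, 1 ≤ y s → 1 ≤ y t → u s = u t → w s = w t)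
    (hmeet : ∀ s ∈ Icc (0 : ℝ) 1, ∀ t ∈ Icc (0 : ℝ) 1, y s = 1 → y t = 1 → u s = u t) :
    ∫ t in (0 : ℝ)..1, w t * u' t = 0 := by
  have huc : ContinuousOn u (Icc 0 1) := fun t ht => (hu t ht).continuousWithinAt
  have hclow : IsClosed (Icc (0 : ℝ) 1 ∩ y ⁻¹' Iic 1) :=
    hy.preimage_isClosed_of_isClosed isClosed_Icc isClosed_Iic
  have hcup : IsClosed (Icc (0 : ℝ) 1 ∩ y ⁻¹' Ici 1) :=
    hy.preimage_isClosed_of_isClosed isClosed_Icc isClosed_Ici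
  obtain ⟨V, hVc, hV⟩ := exists_continuous_comp_eqOn
    (isCompact_Icc.of_isClosed_subset hclow inter_subset_left)
    (huc.mono inter_subset_left) (hw.mono inter_subset_left)
    (fun s hs t ht => hlow s hs.1 t ht.1 hs.2 ht.2)
  obtain ⟨W, hWc, hW⟩ := exists_continuous_comp_eqOn
    (isCompact_Icc.of_isClosed_subset hcup inter_subset_left)
    (huc.mono inter_subset_left) (hw.mono inter_subset_left)
    (fun s hs t ht => hup s hs.1 t ht.1 hs.2 ht.2)
  obtain ⟨c, hc⟩ : ∃ c, ∀ t ∈ Icc (0 : ℝ) 1, y t = 1 → u t = c := by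
    by_cases hex : ∃ s ∈ Icc (0 : ℝ) 1, y s = 1
    · obtain ⟨s, hs, hys⟩ := hex
      exact ⟨u s, fun t ht hyt => hmeet t ht s hs hyt hys⟩
    · push Not at hex
      exact ⟨0, fun t ht hyt => absurd hyt (hex t ht)⟩
  let Ψ : ℝ → ℝ := fun t => if y t ≤ 1 then ∫ z in c..u t, V z else ∫ z in c..u t, W z
  have hprim : ∀ U : ℝ → ℝ, Continuous U → ∀ t ∈ Icc (0 : ℝ) 1,
      HasDerivWithinAt (fun t => ∫ z in c..u t, U z) (U (u t) * u' t) (Icc 0 1) t :=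
    fun U hU t ht => (hU.integral_hasStrictDerivAt c (u t)).hasDerivAt.comp_hasDerivWithinAt t
      (hu t ht)
  have hΨup : ∀ t ∈ Icc (0 : ℝ) 1, 1 ≤ y t → Ψ t = ∫ z in c..u t, W z := by
    intro t ht hyt
    by_cases h1 : y t ≤ 1
    · simp [Ψ, hc t ht (le_antisymm h1 hyt)]
    · simp [Ψ, h1]
  have hderiv : ∀ t ∈ Icc (0 : ℝ) 1, HasDerivWithinAt Ψ (w t * u' t) (Icc 0 1) t := by
    intro t ht
    have hlow' : HasDerivWithinAt Ψ (w t * u' t) (Icc (0 : ℝ) 1 ∩ y ⁻¹' Iic 1) t := by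
      by_cases hy1 : y t ≤ 1
      · rw [hV t ⟨ht, hy1⟩]
        exact ((hprim V hVc t ht).mono inter_subset_left).congr
          (fun s hs => if_pos hs.2) (if_pos hy1)
      · exact hasDerivWithinAt_iff_hasFDerivWithinAt.mpr (.of_notMem_closure <| by rw [hclow.closure_eq]; exact fun h => hy1 h.2)
    have hup' : HasDerivWithinAt Ψ (w t * u' t) (Icc (0 : ℝ) 1 ∩ y ⁻¹' Ici 1) t := by
      by_cases hy1 : 1 ≤ y t
      · rw [hW t ⟨ht, hy1⟩]
        exact ((hprim W hWc t ht).mono inter_subset_left).congr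
          (fun s hs => hΨup s hs.1 hs.2) (hΨup t ht hy1)
      · exact hasDerivWithinAt_iff_hasFDerivWithinAt.mpr (.of_notMem_closure <| by rw [hcup.closure_eq]; exact fun h => hy1 h.2)
    refine (hlow'.union hup').mono fun s hs => ?_
    exact (le_total (y s) 1).imp (fun h => ⟨hs, h⟩) (fun h => ⟨hs, h⟩)
  rw [intervalIntegral.integral_eq_sub_of_hasDerivAt_of_le zero_le_one
    (fun t ht => (hderiv t ht).continuousWithinAt)
    (fun t ht => (hderiv t (Ioo_subset_Icc_self ht)).hasDerivAt (Icc_mem_nhds ht.1 ht.2))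
    ((hw.mul hu'c).intervalIntegrable_of_Icc zero_le_one)]
  simp [Ψ, hu01, hy01]

/-- Two points of the level curve on the same ray from the origin, both with `y ≤ 1` or both with
`y ≥ 1`, coincide. -/
lemma eq_one_of_level_smul {κ h x y l : ℝ} (hκ : κ ≠ 1) (hl : 0 < l)
    (h1 : κ / 3 * y ^ 3 - x ^ 2 * y - h * x ^ 3 - (κ - 1) * y + 2 / 3 * (κ - 1) = 0)
    (h2 : κ / 3 * (l * y) ^ 3 - (l * x) ^ 2 * (l * y) - h * (l * x) ^ 3 - (κ - 1) * (l * y)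
      + 2 / 3 * (κ - 1) = 0)
    (hside : (y ≤ 1 ∧ l * y ≤ 1) ∨ (1 ≤ y ∧ 1 ≤ l * y)) : l = 1 := by
  have h3 : (κ - 1) * ((l - 1) * (y * l * (l + 1) - 2 / 3 * (l ^ 2 + l + 1))) = 0 := by
    linear_combination h2 - l ^ 3 * h1
  have h4 := (mul_eq_zero.mp h3).resolve_left (sub_ne_zero.mpr hκ)
  by_contra hne
  have h5 := (mul_eq_zero.mp h4).resolve_left (sub_ne_zero.mpr hne)
  rcases lt_or_gt_of_ne hne with hlt | hgt <;> rcases hside with ⟨ha, hb⟩ | ⟨ha, hb⟩ <;>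
    nlinarith [mul_pos hl hl, mul_nonneg hl.le (sub_nonneg.mpr ha),
      mul_nonneg hl.le (sub_nonneg.mpr hb),
      mul_nonneg (mul_nonneg hl.le hl.le) (sub_nonneg.mpr ha)]

/-- A connected piece of the level curve in `x > 0` through a point with `y = 0` meets the line
`y = 1` at most once. -/
lemma not_lt_of_eq_one_of_pos {κ h : ℝ} {x y : ℝ → ℝ}
    (hx : ContinuousOn x (Icc 0 1)) (hy : ContinuousOn y (Icc 0 1))
    (hpos : ∀ t ∈ Icc (0 : ℝ) 1, 0 < x t)
    (hlevel : ∀ t ∈ Icc (0 : ℝ) 1, κ / 3 * (y t) ^ 3 - (x t) ^ 2 * y t - h * (x t) ^ 3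
        - (κ - 1) * y t + 2 / 3 * (κ - 1) = 0)
    {r s t : ℝ} (hr : r ∈ Icc (0 : ℝ) 1) (hs : s ∈ Icc (0 : ℝ) 1) (ht : t ∈ Icc (0 : ℝ) 1)
    (hyr : y r = 0) (hys : y s = 1) (hyt : y t = 1) : ¬ x t < x s := by
  intro hlt
  have hratio : ∀ q ∈ Icc (0 : ℝ) 1,
      (y q / x q) ^ 3 / 3 - y q / x q - h
        = -((κ - 1) / 3) * (1 / x q) ^ 3 * (y q - 1) ^ 2 * (y q + 2) := by
    intro q hq
    have := (hpos q hq).ne'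
    field_simp
    linear_combination 3 * hlevel q hq
  set a := 1 / x s with ha
  set b := 1 / x t with hb
  have hapos : 0 < a := one_div_pos.mpr (hpos s hs)
  have hab : a < b := one_div_lt_one_div_of_lt (hpos t ht) hlt
  have hGa : a ^ 3 / 3 - a - h = 0 := by
    have := hratio s hs
    rw [hys] at this
    rw [this]; ring
  have hGb : b ^ 3 / 3 - b - h = 0 := by
    have := hratio t ht
    rw [hyt] at this
    rw [this]; ring
  have hsum : a ^ 2 + a * b + b ^ 2 = 3 := by
    have : (b - a) * (a ^ 2 + a * b + b ^ 2 - 3) = 0 := by linear_combination 3 * hGb - 3 * hGa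
    linarith [(mul_eq_zero.mp this).resolve_left (sub_pos.mpr hab).ne']
  have hh : h = -(a * b * (a + b)) / 3 := by linear_combination -hGa + a / 3 * hsum
  have hbpos := hapos.trans hab
  have hhneg : h < 0 := by
    rw [hh]
    have : 0 < a * b * (a + b) := by positivity
    linarith
  have hκ1 : κ < 1 := by
    have h0 := hlevel r hr
    rw [hyr] at h0
    have := mul_pos (neg_pos.mpr hhneg) (pow_pos (hpos r hr) 3)
    linarith
  have huc : ContinuousOn (fun q => y q / x q) (Icc 0 1) :=
    hy.div hx fun q hq => (hpos q hq).ne'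
  have himg := isPreconnected_Icc.intermediate_value hr ht huc
  obtain ⟨q, hq, hqm⟩ := himg (show (a + b) / 2 ∈ Icc (y r / x r) (y t / x t) by
    rw [hyr, hyt, zero_div, ← hb]
    constructor <;> linarith)
  have hGq := hratio q hq
  simp only at hqm
  have hyq : 0 < y q := by
    have : 0 < y q / x q := by rw [hqm]; linarith
    exact (div_pos_iff_of_pos_right (hpos q hq)).mp this
  have hge : 0 ≤ -((κ - 1) / 3) * (1 / x q) ^ 3 * (y q - 1) ^ 2 * (y q + 2) := by
    have h1 : 0 ≤ -((κ - 1) / 3) := by linarith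
    have h2 := one_div_pos.mpr (hpos q hq)
    positivity
  rw [← hGq, hqm] at hge
  have hfac : ((a + b) / 2) ^ 3 / 3 - (a + b) / 2 - h = -((b - a) ^ 2 * (a + b)) / 8 := by
    linear_combination hGa / 2 + hGb / 2
  have : 0 < (b - a) ^ 2 * (a + b) := by
    have := sub_pos.mpr hab
    positivity
  linarith

lemma forall_pos_or_forall_neg {x : ℝ → ℝ} (hx : ContinuousOn x (Icc 0 1))
    (hxne : ∀ t ∈ Icc (0 : ℝ) 1, x t ≠ 0) :
    (∀ t ∈ Icc (0 : ℝ) 1, 0 < x t) ∨ ∀ t ∈ Icc (0 : ℝ) 1, x t < 0 := by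
  by_contra! hcon
  obtain ⟨⟨s, hs, hxs⟩, t, ht, hxt⟩ := hcon
  obtain ⟨q, hq, hq0⟩ := isPreconnected_Icc.intermediate_value hs ht hx ⟨hxs, hxt⟩
  exact hxne q hq hq0

/-- A connected piece of the level curve with `x ≠ 0` through a point with `y = 0` meets the line
`y = 1` in at most one point. -/
lemma eq_of_eq_one {κ h : ℝ} {x y : ℝ → ℝ}
    (hx : ContinuousOn x (Icc 0 1)) (hy : ContinuousOn y (Icc 0 1))
    (hxne : ∀ t ∈ Icc (0 : ℝ) 1, x t ≠ 0)
    (hlevel : ∀ t ∈ Icc (0 : ℝ) 1, κ / 3 * (y t) ^ 3 - (x t) ^ 2 * y t - h * (x t) ^ 3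
        - (κ - 1) * y t + 2 / 3 * (κ - 1) = 0)
    {r s t : ℝ} (hr : r ∈ Icc (0 : ℝ) 1) (hs : s ∈ Icc (0 : ℝ) 1) (ht : t ∈ Icc (0 : ℝ) 1)
    (hyr : y r = 0) (hys : y s = 1) (hyt : y t = 1) : x s = x t := by
  rcases forall_pos_or_forall_neg hx hxne with hpos | hneg
  · exact le_antisymm
      (not_lt.mp (not_lt_of_eq_one_of_pos hx hy hpos hlevel hr hs ht hyr hys hyt))
      (not_lt.mp (not_lt_of_eq_one_of_pos hx hy hpos hlevel hr ht hs hyr hyt hys))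
  · have hpos' : ∀ q ∈ Icc (0 : ℝ) 1, 0 < -x q := fun q hq => neg_pos.mpr (hneg q hq)
    have hlevel' : ∀ q ∈ Icc (0 : ℝ) 1, κ / 3 * (y q) ^ 3 - (-x q) ^ 2 * y q
        - (-h) * (-x q) ^ 3 - (κ - 1) * y q + 2 / 3 * (κ - 1) = 0 := fun q hq => by
      linear_combination hlevel q hq
    have h1 := not_lt_of_eq_one_of_pos hx.neg hy hpos' hlevel' hr hs ht hyr hys hyt
    have h2 := not_lt_of_eq_one_of_pos hx.neg hy hpos' hlevel' hr ht hs hyr hyt hys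
    simp only [Pi.neg_apply] at h1 h2
    linarith

/-- Two points of the level curve on the same side of the `y`-axis with the same slope `y / x`,
both with `y ≤ 1` or both with `y ≥ 1`, have the same abscissa. -/
lemma eq_of_div_eq_div {κ h x₁ y₁ x₂ y₂ : ℝ} (hκ : κ ≠ 1) (hx : 0 < x₂ / x₁)
    (h1 : κ / 3 * y₁ ^ 3 - x₁ ^ 2 * y₁ - h * x₁ ^ 3 - (κ - 1) * y₁ + 2 / 3 * (κ - 1) = 0)
    (h2 : κ / 3 * y₂ ^ 3 - x₂ ^ 2 * y₂ - h * x₂ ^ 3 - (κ - 1) * y₂ + 2 / 3 * (κ - 1) = 0)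
    (hside : (y₁ ≤ 1 ∧ y₂ ≤ 1) ∨ (1 ≤ y₁ ∧ 1 ≤ y₂)) (hu : y₁ / x₁ = y₂ / x₂) : x₁ = x₂ := by
  have hx₁ : x₁ ≠ 0 := by rintro rfl; simp at hx
  have hx₂ : x₂ ≠ 0 := by rintro rfl; simp at hx
  have ex : x₂ / x₁ * x₁ = x₂ := div_mul_cancel₀ _ hx₁
  have ey : x₂ / x₁ * y₁ = y₂ := by
    rw [div_mul_eq_mul_div, mul_div_assoc, hu, mul_div_cancel₀ _ hx₂]
  rw [← ex, ← ey] at h2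
  rw [← ey] at hside
  have := eq_one_of_level_smul hκ hx h1 h2 hside
  rw [← ex, this, one_mul]

lemma exists_hasDerivAt_zpow (n : ℤ) :
    ∃ L : ℝ → ℝ, ∀ z, z ≠ 0 → HasDerivAt L (z ^ n) z := by
  by_cases hn : n = -1
  · exact ⟨Real.log, fun z hz => by simpa [hn] using Real.hasDerivAt_log hz⟩
  · have hn' : ((n + 1 : ℤ) : ℝ) ≠ 0 := by
      exact_mod_cast fun h => hn (by omega)
    refine ⟨fun z => z ^ (n + 1) / ((n + 1 : ℤ) : ℝ), fun z hz => ?_⟩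
    have := (hasDerivAt_zpow (n + 1) z (Or.inl hz)).div_const ((n + 1 : ℤ) : ℝ)
    rwa [add_sub_cancel_right, mul_div_cancel_left₀ _ hn'] at this

/-- On a loop in the level curve through a point with `y = 0`, the forms `x ^ n K(y / x) dx` have
zero integral. -/
lemma integral_zpow_mul_comp_div_eq_zero {κ h : ℝ} (hκ : κ ≠ 1) {x y x' y' : ℝ → ℝ}
    (hx : ∀ t ∈ Icc (0 : ℝ) 1, HasDerivWithinAt x (x' t) (Icc 0 1) t)
    (hy : ∀ t ∈ Icc (0 : ℝ) 1, HasDerivWithinAt y (y' t) (Icc 0 1) t)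
    (hx'c : ContinuousOn x' (Icc 0 1)) (hy'c : ContinuousOn y' (Icc 0 1))
    (hx01 : x 0 = x 1) (hy01 : y 0 = y 1)
    (hxne : ∀ t ∈ Icc (0 : ℝ) 1, x t ≠ 0)
    (hlevel : ∀ t ∈ Icc (0 : ℝ) 1, κ / 3 * (y t) ^ 3 - (x t) ^ 2 * y t - h * (x t) ^ 3
        - (κ - 1) * y t + 2 / 3 * (κ - 1) = 0)
    {r : ℝ} (hr : r ∈ Icc (0 : ℝ) 1) (hyr : y r = 0)
    (n : ℤ) {K K' : ℝ → ℝ} (hK : ∀ z, HasDerivAt K (K' z) z) (hK' : Continuous K') :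
    ∫ t in (0 : ℝ)..1, x t ^ n * K (y t / x t) * x' t = 0 := by
  obtain ⟨L, hL⟩ := exists_hasDerivAt_zpow n
  have hxc : ContinuousOn x (Icc 0 1) := fun t ht => (hx t ht).continuousWithinAt
  have hyc : ContinuousOn y (Icc 0 1) := fun t ht => (hy t ht).continuousWithinAt
  set u : ℝ → ℝ := fun t => y t / x t with hu_def
  set u' : ℝ → ℝ := fun t => (y' t * x t - y t * x' t) / x t ^ 2 with hu'_def
  have hu : ∀ t ∈ Icc (0 : ℝ) 1, HasDerivWithinAt u (u' t) (Icc 0 1) t :=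
    fun t ht => (hy t ht).fun_div (hx t ht) (hxne t ht)
  have huc : ContinuousOn u (Icc 0 1) := fun t ht => (hu t ht).continuousWithinAt
  have hu'c : ContinuousOn u' (Icc 0 1) :=
    ((hy'c.mul hxc).sub (hyc.mul hx'c)).div (hxc.pow 2) fun t ht => pow_ne_zero 2 (hxne t ht)
  have hLc : ContinuousOn (fun t => L (x t)) (Icc 0 1) := fun t ht =>
    (hL _ (hxne t ht)).continuousAt.comp_continuousWithinAt (hxc t ht)
  have hKu : ContinuousOn (fun t => K (u t)) (Icc 0 1) :=
    (continuous_iff_continuousAt.mpr fun z => (hK z).continuousAt).comp_continuousOn huc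
  have hK'u : ContinuousOn (fun t => K' (u t)) (Icc 0 1) := hK'.comp_continuousOn huc
  have hsign : ∀ s ∈ Icc (0 : ℝ) 1, ∀ t ∈ Icc (0 : ℝ) 1, 0 < x t / x s := by
    intro s hs t ht
    rcases forall_pos_or_forall_neg hxc hxne with hpos | hneg
    · exact div_pos (hpos t ht) (hpos s hs)
    · exact div_pos_of_neg_of_neg (hneg t ht) (hneg s hs)
  have hsheet : ∫ t in (0 : ℝ)..1, (L (x t) * K' (u t)) * u' t = 0 := by
    refine integral_mul_deriv_eq_zero_of_two_sheets hu hu'c (hLc.mul hK'u) hyc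
      (by simp only [hu_def, hx01, hy01]) hy01 ?_ ?_ ?_
    · intro s hs t ht hys hyt hst
      rw [eq_of_div_eq_div hκ (hsign s hs t ht) (hlevel s hs) (hlevel t ht)
        (Or.inl ⟨hys, hyt⟩) hst, hst]
    · intro s hs t ht hys hyt hst
      rw [eq_of_div_eq_div hκ (hsign s hs t ht) (hlevel s hs) (hlevel t ht)
        (Or.inr ⟨hys, hyt⟩) hst, hst]
    · intro s hs t ht hys hyt
      simp only [hu_def, hys, hyt, eq_of_eq_one hxc hyc hxne hlevel hr hs ht hyr hys hyt]
  have hprod : ∀ t ∈ Icc (0 : ℝ) 1, HasDerivWithinAt (fun t => L (x t) * K (u t))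
      (x t ^ n * x' t * K (u t) + L (x t) * (K' (u t) * u' t)) (Icc 0 1) t := fun t ht =>
    ((hL _ (hxne t ht)).comp_hasDerivWithinAt t (hx t ht)).mul
      ((hK (u t)).comp_hasDerivWithinAt t (hu t ht))
  have hi1 : IntervalIntegrable (fun t => x t ^ n * x' t * K (u t)) volume 0 1 :=
    (((hxc.zpow₀ n fun t ht => Or.inl (hxne t ht)).mul hx'c).mul hKu).intervalIntegrable_of_Icc
      zero_le_one
  have hi2 : IntervalIntegrable (fun t => L (x t) * (K' (u t) * u' t)) volume 0 1 :=
    (hLc.mul (hK'u.mul hu'c)).intervalIntegrable_of_Icc zero_le_one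
  have hftc := intervalIntegral.integral_eq_sub_of_hasDerivAt_of_le zero_le_one
    (fun t ht => (hprod t ht).continuousWithinAt)
    (fun t ht => (hprod t (Ioo_subset_Icc_self ht)).hasDerivAt (Icc_mem_nhds ht.1 ht.2))
    (hi1.add hi2)
  rw [intervalIntegral.integral_add hi1 hi2] at hftc
  have hends : L (x 1) * K (u 1) - L (x 0) * K (u 0) = 0 := by simp [hu_def, hx01, hy01]
  rw [hends] at hftc
  simp only [mul_assoc] at hsheet hftc ⊢
  rw [hsheet, add_zero] at hftc
  rw [← hftc]
  congr 1
  ext t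
  ring

/-- The moments `∮ x ^ a y ^ b dx` with `b ≠ 0` vanish on a loop in the level curve through a point
with `y = 0`, whether or not the integrand is integrable. -/
lemma integral_moment_eq_zero {κ h : ℝ} (hκ : κ ≠ 1) {x y x' y' : ℝ → ℝ}
    (hx : ∀ t ∈ Icc (0 : ℝ) 1, HasDerivWithinAt x (x' t) (Icc 0 1) t)
    (hy : ∀ t ∈ Icc (0 : ℝ) 1, HasDerivWithinAt y (y' t) (Icc 0 1) t)
    (hx'c : ContinuousOn x' (Icc 0 1)) (hy'c : ContinuousOn y' (Icc 0 1))
    (hx01 : x 0 = x 1) (hy01 : y 0 = y 1)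
    (hxne : ∀ t ∈ Icc (0 : ℝ) 1, x t ≠ 0)
    (hlevel : ∀ t ∈ Icc (0 : ℝ) 1, κ / 3 * (y t) ^ 3 - (x t) ^ 2 * y t - h * (x t) ^ 3
        - (κ - 1) * y t + 2 / 3 * (κ - 1) = 0)
    {r : ℝ} (hr : r ∈ Icc (0 : ℝ) 1) (hyr : y r = 0) (a : ℤ) {b : ℤ} (hb : b ≠ 0) :
    ∫ t in (0 : ℝ)..1, x t ^ a * y t ^ b * x' t = 0 := by
  by_cases hint : IntervalIntegrable (fun t => x t ^ a * y t ^ b * x' t) volume 0 1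
  swap
  · exact intervalIntegral.integral_undef hint
  have hxc : ContinuousOn x (Icc 0 1) := fun t ht => (hx t ht).continuousWithinAt
  have hyc : ContinuousOn y (Icc 0 1) := fun t ht => (hy t ht).continuousWithinAt
  set N : ℕ := b.natAbs + 1 with hN
  obtain ⟨p, hp⟩ : ∃ p : ℕ, (p : ℤ) = 2 * N + b := ⟨(2 * N + b).toNat, by omega⟩
  let e : ℕ → ℝ := fun m => 1 / ((m : ℝ) + 1)
  have he : ∀ m, 0 < e m := fun m => Nat.one_div_pos_of_nat
  let K : ℕ → ℝ → ℝ := fun m z => z ^ p / (z ^ 2 + e m) ^ N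
  have hden : ∀ m (z : ℝ), (z ^ 2 + e m) ^ N ≠ 0 := fun m z => by
    have := he m
    positivity
  have hKsmooth : ∀ m, ContDiff ℝ 1 (K m) := fun m =>
    (contDiff_id.pow p).div (((contDiff_id.pow 2).add contDiff_const).pow N) (hden m)
  have hKeq : ∀ m z, K m z = z ^ b * (z ^ 2 / (z ^ 2 + e m)) ^ N := by
    intro m z
    rcases eq_or_ne z 0 with rfl | hz
    · have : p ≠ 0 := by omega
      simp [K, zero_zpow b hb, this]
    · have : z ^ p = z ^ b * (z ^ 2) ^ N := by
        rw [← zpow_natCast z p, hp, add_comm, zpow_add₀ hz, ← pow_mul]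
        norm_cast
      simp only [K, div_pow, this, mul_div_assoc]
  have hKle : ∀ m z, |K m z| ≤ |z ^ b| := by
    intro m z
    rw [hKeq, abs_mul]
    refine mul_le_of_le_one_right (abs_nonneg _) ?_
    have h0 : 0 ≤ z ^ 2 / (z ^ 2 + e m) := div_nonneg (sq_nonneg z) (by have := he m; positivity)
    rw [abs_of_nonneg (pow_nonneg h0 N)]
    exact pow_le_one₀ h0 (div_le_one_of_le₀ (by linarith [he m]) (by have := he m; positivity))
  have hKlim : ∀ z, Tendsto (fun m => K m z) atTop (𝓝 (z ^ b)) := by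
    intro z
    simp only [hKeq]
    rcases eq_or_ne z 0 with rfl | hz
    · simp [zero_zpow b hb]
    · have hz2 : z ^ 2 + 0 ≠ 0 := by positivity
      have h1 : Tendsto (fun m => z ^ 2 / (z ^ 2 + e m)) atTop (𝓝 (z ^ 2 / (z ^ 2 + 0))) :=
        tendsto_const_nhds.div (tendsto_const_nhds.add tendsto_one_div_add_atTop_nhds_zero_nat) hz2
      have h2 := (h1.pow N).const_mul (z ^ b)
      rwa [add_zero, div_self (by positivity), one_pow, mul_one] at h2
  have hmom : ∀ t ∈ Icc (0 : ℝ) 1,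
      x t ^ (a + b) * (y t / x t) ^ b * x' t = x t ^ a * y t ^ b * x' t := by
    intro t ht
    have := zpow_ne_zero b (hxne t ht)
    rw [zpow_add₀ (hxne t ht), div_zpow]
    field_simp
  have hsub : uIoc (0 : ℝ) 1 ⊆ Icc 0 1 := by
    rw [uIoc_of_le zero_le_one]
    exact Ioc_subset_Icc_self
  have hlim := intervalIntegral.tendsto_integral_filter_of_dominated_convergence
    (μ := volume) (a := 0) (b := 1) (l := atTop)
    (F := fun m t => x t ^ (a + b) * K m (y t / x t) * x' t)
    (f := fun t => x t ^ a * y t ^ b * x' t)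
    (fun t => ‖x t ^ a * y t ^ b * x' t‖)
    (Eventually.of_forall fun m => by
      have : ContinuousOn (fun t => x t ^ (a + b) * K m (y t / x t) * x' t) (Icc 0 1) :=
        ((hxc.zpow₀ _ fun t ht => Or.inl (hxne t ht)).mul
          ((hKsmooth m).continuous.comp_continuousOn (hyc.div hxc hxne))).mul hx'c
      exact (this.mono hsub).aestronglyMeasurable measurableSet_uIoc)
    (Eventually.of_forall fun m => Eventually.of_forall fun t ht => by
      rw [← hmom t (hsub ht)]
      simp only [norm_mul, Real.norm_eq_abs]
      exact mul_le_mul_of_nonneg_right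
        (mul_le_mul_of_nonneg_left (hKle m _) (abs_nonneg _)) (abs_nonneg _))
    hint.norm
    (Eventually.of_forall fun t ht => by
      rw [← hmom t (hsub ht)]
      exact ((hKlim _).const_mul _).mul_const _)
  have hzero : ∀ m, ∫ t in (0 : ℝ)..1, x t ^ (a + b) * K m (y t / x t) * x' t = 0 := fun m =>
    integral_zpow_mul_comp_div_eq_zero hκ hx hy hx'c hy'c hx01 hy01 hxne hlevel hr hyr (a + b)
      (fun z => ((hKsmooth m).differentiable one_ne_zero z).hasDerivAt)
      ((hKsmooth m).continuous_deriv le_rfl)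
  simp only [hzero] at hlim
  exact tendsto_nhds_unique hlim tendsto_const_nhds

/-- For `κ = 1` the level set is a union of lines through the origin. -/
lemma eq_zero_of_level_of_eq_one {h : ℝ} {x y : ℝ → ℝ}
    (hx : ContinuousOn x (Icc 0 1)) (hy : ContinuousOn y (Icc 0 1))
    (hxne : ∀ t ∈ Icc (0 : ℝ) 1, x t ≠ 0)
    (hlevel : ∀ t ∈ Icc (0 : ℝ) 1, 1 / 3 * (y t) ^ 3 - (x t) ^ 2 * y t - h * (x t) ^ 3 = 0)
    {r : ℝ} (hr : r ∈ Icc (0 : ℝ) 1) (hyr : y r = 0) : ∀ t ∈ Icc (0 : ℝ) 1, y t = 0 := by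
  have hh : h = 0 := by
    have := hlevel r hr
    rw [hyr] at this
    simpa [hxne r hr] using this
  have huc : ContinuousOn (fun t => (y t / x t) ^ 2) (Icc 0 1) := (hy.div hx hxne).pow 2
  have hval : ∀ t ∈ Icc (0 : ℝ) 1, y t = 0 ∨ (y t / x t) ^ 2 = 3 := by
    intro t ht
    have h1 : y t * (y t ^ 2 - 3 * x t ^ 2) = 0 := by
      linear_combination 3 * hlevel t ht + 3 * x t ^ 3 * hh
    refine (mul_eq_zero.mp h1).imp_right fun h2 => ?_
    rw [div_pow, div_eq_iff (pow_ne_zero 2 (hxne t ht))]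
    linarith
  intro t ht
  refine (hval t ht).resolve_right fun h3 => ?_
  obtain ⟨q, hq, hq1⟩ := isPreconnected_Icc.intermediate_value hr ht huc
    (show (1 : ℝ) ∈ Icc _ _ by simp only [hyr, h3]; norm_num)
  simp only at hq1
  rcases hval q hq with h0 | h0
  · simp [h0] at hq1
  · linarith

lemma hasDerivWithinAt_zpow_mul_zpow {x y : ℝ → ℝ} {x' y' t : ℝ} {s : Set ℝ}
    (hx : HasDerivWithinAt x x' s t) (hy : HasDerivWithinAt y y' s t) (hx0 : x t ≠ 0)
    (a : ℤ) {b : ℤ} (hb : y t ≠ 0 ∨ 0 ≤ b) :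
    HasDerivWithinAt (fun t => x t ^ a * y t ^ b)
      (a * x t ^ (a - 1) * x' * y t ^ b + x t ^ a * (b * y t ^ (b - 1) * y')) s t :=
  ((hasDerivAt_zpow a (x t) (Or.inl hx0)).comp_hasDerivWithinAt t hx).mul
    ((hasDerivAt_zpow b (y t) hb).comp_hasDerivWithinAt t hy)


/-- Line-integral form of the recurrence
`κ(i+j+5)I_{i,j+3} − (i+j+5)I_{i+2,j+1} − (κ−1)(i+3j+7)I_{i,j+1} + 2(κ−1)(j+1)I_{i,j} = 0`
for a closed curve on the cubic level set
`(κ/3)y³ − x²y − hx³ − (κ−1)y + (2/3)(κ−1) = 0`, where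
`A a b = ∫₀¹ x(t)^a y(t)^b x'(t) dt`. -/
theorem moment_recurrence_on_level_curve (κ h : ℝ)
    (x y x' y' : ℝ → ℝ)
    (hx : ∀ t ∈ Set.Icc (0 : ℝ) 1, HasDerivWithinAt x (x' t) (Set.Icc 0 1) t)
    (hy : ∀ t ∈ Set.Icc (0 : ℝ) 1, HasDerivWithinAt y (y' t) (Set.Icc 0 1) t)
    (hx'c : ContinuousOn x' (Set.Icc 0 1))
    (hy'c : ContinuousOn y' (Set.Icc 0 1))
    (hclosed : x 0 = x 1 ∧ y 0 = y 1)
    (hxne : ∀ t ∈ Set.Icc (0 : ℝ) 1, x t ≠ 0)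
    (hlevel : ∀ t ∈ Set.Icc (0 : ℝ) 1,
      κ / 3 * (y t) ^ 3 - (x t) ^ 2 * y t - h * (x t) ^ 3
        - (κ - 1) * y t + 2 / 3 * (κ - 1) = 0)
    (A : ℤ → ℤ → ℝ)
    (hA : ∀ a b : ℤ, A a b = ∫ t in (0 : ℝ)..1, (x t) ^ a * (y t) ^ b * x' t) :
    ∀ i j : ℤ, j ≠ -1 → j ≠ -2 → j ≠ -4 →
      κ * ((i : ℝ) + (j : ℝ) + 5) / ((j : ℝ) + 4) * A i (j + 4)
        - ((i : ℝ) + (j : ℝ) + 5) / ((j : ℝ) + 2) * A (i + 2) (j + 2)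
        - (κ - 1) * ((i : ℝ) + 3 * (j : ℝ) + 7) / ((j : ℝ) + 2) * A i (j + 2)
        + 2 * (κ - 1) * A i (j + 1) = 0 := by
  intro i j hj1 hj2 hj4
  obtain ⟨hx01, hy01⟩ := hclosed
  have hxc : ContinuousOn x (Icc 0 1) := fun t ht => (hx t ht).continuousWithinAt
  have hyc : ContinuousOn y (Icc 0 1) := fun t ht => (hy t ht).continuousWithinAt
  by_cases hreg : (∀ t ∈ Icc (0 : ℝ) 1, y t ≠ 0) ∨ 0 ≤ j
  swap
  · push Not at hreg
    obtain ⟨⟨r, hr, hyr⟩, hj⟩ := hreg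
    have hzero : ∀ a b : ℤ, b ≠ 0 → A a b = 0 := by
      intro a b hb
      rw [hA]
      by_cases hκ : κ = 1
      · have hy0 : ∀ t ∈ Icc (0 : ℝ) 1, y t = 0 :=
          eq_zero_of_level_of_eq_one (h := h) hxc hyc hxne (fun t ht => by
            have := hlevel t ht
            rw [hκ] at this
            linear_combination this) hr hyr
        rw [intervalIntegral.integral_congr (g := fun _ => 0), intervalIntegral.integral_zero]
        intro t ht
        rw [uIcc_of_le zero_le_one] at ht
        simp [hy0 t ht, zero_zpow b hb]
      · exact integral_moment_eq_zero hκ hx hy hx'c hy'c hx01 hy01 hxne hlevel hr hyr a hb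
    rw [hzero _ _ (by omega : j + 4 ≠ 0), hzero _ _ (by omega : j + 2 ≠ 0),
      hzero _ _ (by omega : j + 2 ≠ 0), hzero _ _ (by omega : j + 1 ≠ 0)]
    ring
  have hreg' : ∀ t ∈ Icc (0 : ℝ) 1, y t ≠ 0 ∨ 0 ≤ j := fun t ht => hreg.imp_left fun H => H t ht
  have hj2' : (j : ℝ) + 2 ≠ 0 := by exact_mod_cast (by omega : j + 2 ≠ 0)
  have hj4' : (j : ℝ) + 4 ≠ 0 := by exact_mod_cast (by omega : j + 4 ≠ 0)
  have hint : ∀ a b : ℤ, j + 1 ≤ b →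
      IntervalIntegrable (fun t => x t ^ a * y t ^ b * x' t) volume 0 1 := fun a b hb =>
    (((hxc.zpow₀ a fun t ht => Or.inl (hxne t ht)).mul
      (hyc.zpow₀ b fun t ht => (hreg' t ht).imp_right fun H => by omega)).mul
        hx'c).intervalIntegrable_of_Icc zero_le_one
  have htangent : ∀ t ∈ Ioo (0 : ℝ) 1,
      (-2 * x t * y t - 3 * h * x t ^ 2) * x' t
        + (κ * y t ^ 2 - x t ^ 2 - (κ - 1)) * y' t = 0 := by
    intro t ht
    have htI := Ioo_subset_Icc_self ht
    have hnhds : Icc (0 : ℝ) 1 ∈ 𝓝 t := Icc_mem_nhds ht.1 ht.2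
    have hX := (hx t htI).hasDerivAt hnhds
    have hY := (hy t htI).hasDerivAt hnhds
    have hH := ((((hY.fun_pow 3).const_mul (κ / 3)).sub ((hX.fun_pow 2).mul hY)).sub
      ((hX.fun_pow 3).const_mul h)).sub (hY.const_mul (κ - 1)) |>.add_const (2 / 3 * (κ - 1))
    have h0 := hH.unique ((hasDerivAt_const t (0 : ℝ)).congr_of_eventuallyEq
      (eventually_of_mem hnhds fun q hq => hlevel q hq))
    norm_num at h0
    linear_combination h0
  let B : ℝ → ℝ := fun t => κ / (j + 4) * (x t ^ (i + 1) * y t ^ (j + 4))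
    - 1 / (j + 2) * (x t ^ (i + 3) * y t ^ (j + 2))
    - (κ - 1) / (j + 2) * (x t ^ (i + 1) * y t ^ (j + 2))
  let g : ℝ → ℝ := fun t =>
    κ * ((i : ℝ) + j + 5) / (j + 4) * (x t ^ i * y t ^ (j + 4) * x' t)
      - ((i : ℝ) + j + 5) / (j + 2) * (x t ^ (i + 2) * y t ^ (j + 2) * x' t)
      - (κ - 1) * ((i : ℝ) + 3 * j + 7) / (j + 2) * (x t ^ i * y t ^ (j + 2) * x' t)
      + 2 * (κ - 1) * (x t ^ i * y t ^ (j + 1) * x' t)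
  have hB : ∀ t ∈ Icc (0 : ℝ) 1, HasDerivWithinAt B
      (κ / (j + 4) * (((i + 1 : ℤ) : ℝ) * x t ^ (i + 1 - 1) * x' t * y t ^ (j + 4)
          + x t ^ (i + 1) * (((j + 4 : ℤ) : ℝ) * y t ^ (j + 4 - 1) * y' t))
        - 1 / (j + 2) * (((i + 3 : ℤ) : ℝ) * x t ^ (i + 3 - 1) * x' t * y t ^ (j + 2)
          + x t ^ (i + 3) * (((j + 2 : ℤ) : ℝ) * y t ^ (j + 2 - 1) * y' t))
        - (κ - 1) / (j + 2) * (((i + 1 : ℤ) : ℝ) * x t ^ (i + 1 - 1) * x' t * y t ^ (j + 2)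
          + x t ^ (i + 1) * (((j + 2 : ℤ) : ℝ) * y t ^ (j + 2 - 1) * y' t))) (Icc 0 1) t := by
    intro t ht
    have hpow := fun (a b : ℤ) (hb : j ≤ b) => hasDerivWithinAt_zpow_mul_zpow (hx t ht) (hy t ht)
      (hxne t ht) a (b := b) ((hreg' t ht).imp_right fun H => H.trans hb)
    exact (((hpow (i + 1) (j + 4) (by omega)).const_mul _).sub
      ((hpow (i + 3) (j + 2) (by omega)).const_mul _)).sub
      ((hpow (i + 1) (j + 2) (by omega)).const_mul _)
  have hBg : ∀ t ∈ Ioo (0 : ℝ) 1, HasDerivAt B (g t) t := by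
    intro t ht
    have htI := Ioo_subset_Icc_self ht
    refine ((hB t htI).hasDerivAt (Icc_mem_nhds ht.1 ht.2)).congr_deriv ?_
    have hx0 := hxne t htI
    have hyadd : ∀ k : ℕ, y t ^ (j + 1 + (k : ℤ)) = y t ^ (j + 1) * y t ^ k := by
      intro k
      rcases hreg' t htI with H | H
      · rw [zpow_add₀ H, zpow_natCast]
      · lift j to ℕ using H
        exact_mod_cast pow_add (y t) (j + 1) k
    have ey2 : y t ^ (j + 2) = y t ^ (j + 1) * y t := by
      simpa [add_assoc] using hyadd 1
    have ey3 : y t ^ (j + 4 - 1) = y t ^ (j + 1) * y t ^ 2 := by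
      rw [← hyadd 2]; congr 1; push_cast; ring
    have ey4 : y t ^ (j + 4) = y t ^ (j + 1) * y t ^ 3 := by
      rw [← hyadd 3]; congr 1; push_cast; ring
    have ex1 : x t ^ (i + 1) = x t ^ i * x t := zpow_add_one₀ hx0 i
    have ex2 : x t ^ (i + 2) = x t ^ i * x t ^ 2 := by
      rw [zpow_add₀ hx0]; norm_cast
    have ex3 : x t ^ (i + 3) = x t ^ i * x t ^ 3 := by
      rw [zpow_add₀ hx0]; norm_cast
    simp only [g, show i + 1 - 1 = i by ring, show i + 3 - 1 = i + 2 by ring,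
      show j + 2 - 1 = j + 1 by ring, ey2, ey3, ey4, ex1, ex2, ex3]
    push_cast
    field_simp
    linear_combination ((j : ℝ) + 4) * ((j : ℝ) + 2) * y t ^ (j + 1)
      * (x t * htangent t ht - 3 * x' t * hlevel t htI)
  have hi1 := (hint i (j + 4) (by omega)).const_mul (κ * ((i : ℝ) + j + 5) / (j + 4))
  have hi2 := (hint (i + 2) (j + 2) (by omega)).const_mul (((i : ℝ) + j + 5) / (j + 2))
  have hi3 := (hint i (j + 2) (by omega)).const_mul ((κ - 1) * ((i : ℝ) + 3 * j + 7) / (j + 2))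
  have hi4 := (hint i (j + 1) le_rfl).const_mul (2 * (κ - 1))
  have hftc : ∫ t in (0 : ℝ)..1, g t = B 1 - B 0 :=
    intervalIntegral.integral_eq_sub_of_hasDerivAt_of_le zero_le_one
      (fun t ht => (hB t ht).continuousWithinAt) hBg (((hi1.sub hi2).sub hi3).add hi4)
  have hends : B 1 - B 0 = 0 := by simp only [B, hx01, hy01, sub_self]
  rw [hends] at hftc
  simp only [g] at hftc
  rw [intervalIntegral.integral_add ((hi1.sub hi2).sub hi3) hi4,
    intervalIntegral.integral_sub (hi1.sub hi2) hi3, intervalIntegral.integral_sub hi1 hi2] at hftc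
  simp only [intervalIntegral.integral_const_mul, ← hA] at hftc
  exact hftc
end

section
/- Let κ, h ∈ ℝ with κ ≠ 1, and let γ(t) = (x(t), y(t)), t ∈ [0,1], be a continuously differentiable closed curve with x(t) ≠ 0 for all t, lying on the level set (κ/3)y³ − x²y − hx³ − (κ−1)y + (2/3)(κ−1) = 0. Then 2·∫₀¹ x(t)⁻⁶ y(t)³ x'(t) dt = 3·∫₀¹ x(t)⁻⁶ y(t)² x'(t) dt. -/
/-- The identity `I_{−6,2} = I_{−6,1}` in line-integral form: for a closed curve on the
cubic level set `(κ/3)y³ − x²y − hx³ − (κ−1)y + (2/3)(κ−1) = 0` with `x(t) ≠ 0`,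
`2·∮ x⁻⁶y³ dx = 3·∮ x⁻⁶y² dx`. -/
theorem I_minus6_2_eq_I_minus6_1 (κ h : ℝ) (hκ : κ ≠ 1)
    (x y x' y' : ℝ → ℝ)
    (hx : ∀ t ∈ Set.Icc (0 : ℝ) 1, HasDerivWithinAt x (x' t) (Set.Icc 0 1) t)
    (hy : ∀ t ∈ Set.Icc (0 : ℝ) 1, HasDerivWithinAt y (y' t) (Set.Icc 0 1) t)
    (hx'c : ContinuousOn x' (Set.Icc 0 1))
    (hy'c : ContinuousOn y' (Set.Icc 0 1))
    (hclosed : x 0 = x 1 ∧ y 0 = y 1)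
    (hxne : ∀ t ∈ Set.Icc (0 : ℝ) 1, x t ≠ 0)
    (hlevel : ∀ t ∈ Set.Icc (0 : ℝ) 1,
      κ / 3 * (y t) ^ 3 - (x t) ^ 2 * y t - h * (x t) ^ 3
        - (κ - 1) * y t + 2 / 3 * (κ - 1) = 0) :
    2 * ∫ t in (0 : ℝ)..1, (x t) ^ (-6 : ℤ) * (y t) ^ 3 * x' t =
      3 * ∫ t in (0 : ℝ)..1, (x t) ^ (-6 : ℤ) * (y t) ^ 2 * x' t := by
  have hc : κ - 1 ≠ 0 := sub_ne_zero.mpr hκ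
  have hxc : ContinuousOn x (Set.Icc 0 1) := fun t ht => (hx t ht).continuousWithinAt
  have hyc : ContinuousOn y (Set.Icc 0 1) := fun t ht => (hy t ht).continuousWithinAt
  have hcont : ∀ n : ℕ,
      ContinuousOn (fun t => (x t) ^ (-6 : ℤ) * (y t) ^ n * x' t) (Set.Icc 0 1) := fun n =>
    ((hxc.zpow₀ (-6) fun t ht => Or.inl (hxne t ht)).mul (hyc.pow n)).mul hx'c
  have hint : ∀ n : ℕ, IntervalIntegrable
      (fun t => (x t) ^ (-6 : ℤ) * (y t) ^ n * x' t) MeasureTheory.volume 0 1 := fun n =>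
    (hcont n).intervalIntegrable_of_Icc zero_le_one
  -- A primitive of the difference of the two integrands along the level curve.
  let F : ℝ → ℝ := fun t => 3 / (2 * (κ - 1)) *
    ((y t) ^ 3 / (3 * (x t) ^ 3) + (κ - 1) * (y t) ^ 3 / (3 * (x t) ^ 5)
      - κ * (y t) ^ 5 / (5 * (x t) ^ 5))
  have hFc : ContinuousOn F (Set.Icc 0 1) := by
    refine continuousOn_const.mul (((((hyc.pow 3).div (continuousOn_const.mul (hxc.pow 3)) ?_).add
      ((continuousOn_const.mul (hyc.pow 3)).div (continuousOn_const.mul (hxc.pow 5)) ?_))).sub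
      ((continuousOn_const.mul (hyc.pow 5)).div (continuousOn_const.mul (hxc.pow 5)) ?_)) <;>
    exact fun t ht => mul_ne_zero (by norm_num) (pow_ne_zero _ (hxne t ht))
  have hF : ∀ t ∈ Set.Ioo (0 : ℝ) 1, HasDerivAt F
      (2 * ((x t) ^ (-6 : ℤ) * (y t) ^ 3 * x' t) -
        3 * ((x t) ^ (-6 : ℤ) * (y t) ^ 2 * x' t)) t := by
    intro t ht
    have htI := Set.Ioo_subset_Icc_self ht
    have hnhds := Icc_mem_nhds ht.1 ht.2
    have hxt := (hx t htI).hasDerivAt hnhds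
    have hyt := (hy t htI).hasDerivAt hnhds
    have hx0 := hxne t htI
    have hH := (((((hyt.pow 3).const_mul (κ / 3)).sub ((hxt.pow 2).mul hyt)).sub
      ((hxt.pow 3).const_mul h)).sub (hyt.const_mul (κ - 1))).add_const (2 / 3 * (κ - 1))
    have hH0 := hH.unique ((hasDerivAt_const t (0 : ℝ)).congr_of_eventuallyEq
      (Filter.eventually_of_mem hnhds fun s hs => by simpa using hlevel s hs))
    have hrel : (κ * y t ^ 3 - x t ^ 2 * y t - 3 * (κ - 1) * y t + 2 * (κ - 1)) * x' t
        = x t * (κ * y t ^ 2 - x t ^ 2 - (κ - 1)) * y' t := by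
      have hl := hlevel t htI
      norm_num at hH0
      linear_combination 3 * x' t * hl - x t * hH0
    have hF' := ((((hyt.pow 3).div ((hxt.pow 3).const_mul 3) (by simpa using hx0)).add
      (((hyt.pow 3).const_mul (κ - 1)).div ((hxt.pow 5).const_mul 3) (by simpa using hx0))).sub
      (((hyt.pow 5).const_mul κ).div ((hxt.pow 5).const_mul 5) (by simpa using hx0))).const_mul
      (3 / (2 * (κ - 1)))
    refine hF'.congr_deriv ?_
    have hz : (x t) ^ (-6 : ℤ) = ((x t) ^ 6)⁻¹ := by
      rw [zpow_neg]; norm_cast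
    rw [hz]
    norm_num
    field_simp
    linear_combination 3 * y t ^ 2 * hrel
  have hFTC := intervalIntegral.integral_eq_sub_of_hasDerivAt_of_le zero_le_one hFc hF
    (((hint 3).const_mul 2).sub ((hint 2).const_mul 3))
  rw [intervalIntegral.integral_sub ((hint 3).const_mul 2) ((hint 2).const_mul 3),
    intervalIntegral.integral_const_mul, intervalIntegral.integral_const_mul] at hFTC
  have hends : F 1 - F 0 = 0 := by simp [F, hclosed.1, hclosed.2]
  exact sub_eq_zero.mp (hFTC.trans hends)
end
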